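/- arXiv:2108.11336 — 2 statements merged into one kernel-verified Lean document; each statement's English description precedes it below -/
import Mathlib

section
/- For the noise-free linear regression model y_k = φ_{k−1}ᵀθ* with estimates produced by the projection algorithm, if the regressor sequence {φ_k} is persistently exciting, then the parameter estimates converge to the true value: lim_{k→∞} θ_k = θ*. -/
open scoped RealInnerProductSpace
open Filter Matrix

/-- A bounded sequence `φ : ℕ → ℝ^N` is persistently exciting if there exist `T` and
`α > 0` such that `Σ_{k=t}^{t+T} φ_k φ_kᵀ ⪰ α I` (positive semidefinite order) for all `t`. -/
def PersistentlyExcitingSeq {N : ℕ} (φ : ℕ → EuclideanSpace ℝ (Fin N)) : Prop :=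
  (∃ B : ℝ, ∀ k, ‖φ k‖ ≤ B) ∧
    ∃ T : ℕ, ∃ α : ℝ, 0 < α ∧ ∀ t : ℕ,
      ((∑ k ∈ Finset.Icc t (t + T), Matrix.vecMulVec (φ k) (φ k)) -
        α • (1 : Matrix (Fin N) (Fin N) ℝ)).PosSemidef

/-- Persistent excitation bounds `α ‖x‖²` by the energy of `x` along any window of regressors. -/
lemma mul_norm_sq_le_sum_inner_sq {N : ℕ} {φ : ℕ → EuclideanSpace ℝ (Fin N)} {α : ℝ}
    {s : Finset ℕ}
    (h : ((∑ k ∈ s, Matrix.vecMulVec (φ k) (φ k)) -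
      α • (1 : Matrix (Fin N) (Fin N) ℝ)).PosSemidef)
    (x : EuclideanSpace ℝ (Fin N)) :
    α * ‖x‖ ^ 2 ≤ ∑ k ∈ s, ⟪φ k, x⟫ ^ 2 := by
  have hx := h.dotProduct_mulVec_nonneg x
  have hinner (k : ℕ) : ⟪φ k, x⟫ = (φ k : Fin N → ℝ) ⬝ᵥ (x : Fin N → ℝ) := by
    simp [PiLp.inner_apply, dotProduct, mul_comm]
  have hnorm : ‖x‖ ^ 2 = (x : Fin N → ℝ) ⬝ᵥ (x : Fin N → ℝ) := by
    rw [EuclideanSpace.real_norm_sq_eq]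
    simp only [dotProduct, sq]
  have hterm (k : ℕ) : (x : Fin N → ℝ) ⬝ᵥ (vecMulVec (φ k) (φ k) *ᵥ (x : Fin N → ℝ)) =
      ⟪φ k, x⟫ ^ 2 := by
    rw [vecMulVec_mulVec, hinner, dotProduct_smul, dotProduct_comm (x : Fin N → ℝ)]
    simp [sq]
  simp only [sub_mulVec, sum_mulVec, smul_mulVec, one_mulVec, dotProduct_sub, dotProduct_sum,
    dotProduct_smul, star_trivial, smul_eq_mul, hterm, ← hnorm] at hx
  linarith

/-- A sequence with vanishing increments has vanishing increments over any fixed lag. -/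
lemma tendsto_add_sub_of_tendsto_succ_sub {E : Type*} [NormedAddCommGroup E] {e : ℕ → E}
    (h : Tendsto (fun k => e (k + 1) - e k) atTop (nhds 0)) (i : ℕ) :
    Tendsto (fun k => e (k + i) - e k) atTop (nhds 0) := by
  induction i with
  | zero => simp
  | succ i ih =>
    simpa [add_assoc] using (h.comp (tendsto_add_atTop_nat i)).add ih

/-- A slowly varying sequence that is asymptotically orthogonal to a persistently exciting
sequence tends to zero. -/
lemma PersistentlyExcitingSeq.tendsto_zero {N : ℕ} {φ e : ℕ → EuclideanSpace ℝ (Fin N)}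
    (hφ : PersistentlyExcitingSeq φ)
    (horth : Tendsto (fun k => ⟪φ k, e k⟫) atTop (nhds 0))
    (hslow : Tendsto (fun k => e (k + 1) - e k) atTop (nhds 0)) :
    Tendsto e atTop (nhds 0) := by
  obtain ⟨⟨B, hB⟩, T, α, hα, hPE⟩ := hφ
  have hlag (i : ℕ) : Tendsto (fun t => ⟪φ (t + i), e t⟫) atTop (nhds 0) := by
    have hdiff : Tendsto (fun t => ⟪φ (t + i), e (t + i) - e t⟫) atTop (nhds 0) := by
      refine squeeze_zero_norm (a := fun t => B * ‖e (t + i) - e t‖) (fun t => ?_) ?_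
      · exact (norm_inner_le_norm _ _).trans (by gcongr; exact hB _)
      · simpa using (tendsto_add_sub_of_tendsto_succ_sub hslow i).norm.const_mul B
    have := (horth.comp (tendsto_add_atTop_nat i)).sub hdiff
    simpa [inner_sub_right] using this
  have hsum : Tendsto (fun t => ∑ k ∈ Finset.Icc t (t + T), ⟪φ k, e t⟫ ^ 2) atTop (nhds 0) := by
    have hrange (t : ℕ) : ∑ k ∈ Finset.Icc t (t + T), ⟪φ k, e t⟫ ^ 2 =
        ∑ i ∈ Finset.range (T + 1), ⟪φ (t + i), e t⟫ ^ 2 := by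
      rw [← Finset.Ico_add_one_right_eq_Icc, Finset.sum_Ico_eq_sum_range]
      congr 2
      omega
    simp only [hrange]
    simpa using tendsto_finsetSum (Finset.range (T + 1)) fun i _ => (hlag i).pow 2
  have hsq : Tendsto (fun t => ‖e t‖ ^ 2) atTop (nhds 0) := by
    refine squeeze_zero (fun t => sq_nonneg _) (fun t => ?_)
      (by simpa using hsum.const_mul α⁻¹)
    rw [← div_eq_inv_mul, le_div_iff₀' hα]
    exact mul_norm_sq_le_sum_inner_sq (hPE t) (e t)
  rw [tendsto_zero_iff_norm_tendsto_zero]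
  simpa using hsq.sqrt

/-- One step of the projection algorithm decreases the squared error. -/
lemma norm_sq_projection_step_le {E : Type*} [NormedAddCommGroup E] [InnerProductSpace ℝ E]
    (γ : ℝ) (p e : E) :
    ‖e - (γ / (1 + ‖p‖ ^ 2)) • (⟪p, e⟫ • p)‖ ^ 2 ≤
      ‖e‖ ^ 2 - γ * (2 - γ) / (1 + ‖p‖ ^ 2) * ⟪p, e⟫ ^ 2 := by
  have hpos : 0 < 1 + ‖p‖ ^ 2 := by positivity
  rw [norm_sub_sq_real, smul_smul, inner_smul_right, norm_smul, real_inner_comm p e, mul_pow _ ‖p‖,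
    Real.norm_eq_abs, sq_abs]
  have hle : ‖p‖ ^ 2 / (1 + ‖p‖ ^ 2) ≤ 1 := by
    rw [div_le_one hpos]
    linarith
  have hmul := mul_le_mul_of_nonneg_left hle
    (show 0 ≤ γ ^ 2 * ⟪p, e⟫ ^ 2 / (1 + ‖p‖ ^ 2) by positivity)
  have hexp : (γ / (1 + ‖p‖ ^ 2) * ⟪p, e⟫) ^ 2 * ‖p‖ ^ 2 =
      γ ^ 2 * ⟪p, e⟫ ^ 2 / (1 + ‖p‖ ^ 2) * (‖p‖ ^ 2 / (1 + ‖p‖ ^ 2)) := by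
    field_simp
  rw [hexp]
  refine (add_le_add_right hmul _).trans (le_of_eq ?_)
  field_simp
  ring

/-- A sequence dominated by the decrements of a nonnegative sequence tends to zero. -/
lemma tendsto_zero_of_le_sub_succ {a V : ℕ → ℝ} (ha : ∀ k, 0 ≤ a k) (hV : ∀ k, 0 ≤ V k)
    (h : ∀ k, a k ≤ V k - V (k + 1)) : Tendsto a atTop (nhds 0) := by
  have hanti : Antitone V := antitone_nat_of_succ_le fun k => by linarith [ha k, h k]
  have hlim := tendsto_atTop_ciInf hanti ⟨0, Set.forall_mem_range.2 hV⟩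
  refine squeeze_zero ha h ?_
  simpa using hlim.sub (hlim.comp (tendsto_add_atTop_nat 1))

/-- **Projection algorithm, noise-free case: persistent excitation implies parameter
convergence.** For the linear regression model `y k = ⟪φ (k-1), θ*⟫` (noise free) and
estimates produced by the projection algorithm with gain `0 < γ < 2`, if the regressor
sequence `φ` is persistently exciting then `θ k → θ*`. -/
theorem projection_algorithm_PE_implies_convergence
    (N : ℕ) (θstar : EuclideanSpace ℝ (Fin N)) (φ : ℕ → EuclideanSpace ℝ (Fin N))
    (y : ℕ → ℝ) (θ : ℕ → EuclideanSpace ℝ (Fin N)) (γ : ℝ)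
    (hγ0 : 0 < γ) (hγ2 : γ < 2)
    (hmodel : ∀ k : ℕ, y (k + 1) = ⟪φ k, θstar⟫)
    (hupdate : ∀ k : ℕ,
      θ (k + 1) = θ k + (γ / (1 + ⟪φ k, φ k⟫)) • ((y (k + 1) - ⟪φ k, θ k⟫) • φ k))
    (hPE : PersistentlyExcitingSeq φ) :
    Tendsto θ atTop (nhds θstar) := by
  set e : ℕ → EuclideanSpace ℝ (Fin N) := fun k => θ k - θstar with he
  have hstep (k : ℕ) : e (k + 1) = e k - (γ / (1 + ‖φ k‖ ^ 2)) • (⟪φ k, e k⟫ • φ k) := by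
    have hres : y (k + 1) - ⟪φ k, θ k⟫ = -⟪φ k, e k⟫ := by
      rw [hmodel, he, inner_sub_right, neg_sub]
    simp only [he] at hres ⊢
    rw [hupdate, hres, real_inner_self_eq_norm_sq, neg_smul, smul_neg]
    abel
  obtain ⟨B, hB⟩ := hPE.1
  have hc : 0 < γ * (2 - γ) / (1 + B ^ 2) :=
    div_pos (mul_pos hγ0 (by linarith)) (by positivity)
  have hdecr (k : ℕ) : γ * (2 - γ) / (1 + B ^ 2) * ⟪φ k, e k⟫ ^ 2 ≤
      ‖e k‖ ^ 2 - ‖e (k + 1)‖ ^ 2 := by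
    have hle := norm_sq_projection_step_le γ (φ k) (e k)
    rw [← hstep] at hle
    have hγ : 0 ≤ γ * (2 - γ) := mul_nonneg hγ0.le (by linarith)
    have : γ * (2 - γ) / (1 + B ^ 2) * ⟪φ k, e k⟫ ^ 2 ≤
        γ * (2 - γ) / (1 + ‖φ k‖ ^ 2) * ⟪φ k, e k⟫ ^ 2 := by
      gcongr
      exact hB k
    linarith
  have horth : Tendsto (fun k => ⟪φ k, e k⟫) atTop (nhds 0) := by
    have hsq := (tendsto_zero_of_le_sub_succ (fun k => by positivity)
      (fun k => sq_nonneg ‖e k‖) hdecr).const_mul (γ * (2 - γ) / (1 + B ^ 2))⁻¹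
    simp only [inv_mul_cancel_left₀ hc.ne', mul_zero] at hsq
    rw [tendsto_zero_iff_abs_tendsto_zero]
    simpa [Function.comp_def, Real.sqrt_sq_eq_abs] using hsq.sqrt
  have hslow : Tendsto (fun k => e (k + 1) - e k) atTop (nhds 0) := by
    refine squeeze_zero_norm (a := fun k => γ * B * |⟪φ k, e k⟫|) (fun k => ?_) ?_
    · have hgain : γ / (1 + ‖φ k‖ ^ 2) ≤ γ :=
        div_le_self hγ0.le (by linarith [sq_nonneg ‖φ k‖])
      rw [hstep, sub_sub_cancel_left, norm_neg, norm_smul, norm_smul, Real.norm_eq_abs,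
        Real.norm_eq_abs, abs_of_nonneg (by positivity), mul_assoc, mul_comm B]
      gcongr
      exact hB k
    · simpa using horth.abs.const_mul (γ * B)
  simpa [he] using (hPE.tendsto_zero horth hslow).add_const θstar
end

section
/- Consider the adaptive system with bounded disturbance: plant ẋ = Ax + bu + v with ‖v(t)‖ ≤ v_max for all t; control u = k(t)ᵀx + r; matching condition A + b k*ᵀ = A_m with A_m Hurwitz; reference model ẋ_m = A_m x_m + b r; error e = x − x_m; adaptive law k̇ = −γ (eᵀPb) x with γ > 0, where P = Pᵀ ≻ 0 solves A_mᵀP + P A_m = −Q, Q = Qᵀ ≻ 0. Suppose the reference model state x_m is persistently exciting with level ε₀, i.e. there exist T₀ > 0 and δ₀ > 0 such that for every t ≥ t₀ and every unit vector w ∈ ℝ^n there is a subinterval [t₂, t₂+δ₀] ⊂ [t, t+T₀] with |(1/T₀) ∫_{t₂}^{t₂+δ₀} x_m(τ)ᵀ w dτ| ≥ ε₀. If ε₀ > k₀ v_max, where k₀ = 2 λ_max(P)/λ_min(Q), then all solutions (e(t), k(t)) of the closed-loop adaptive system are globally bounded. -/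
open scoped RealInnerProductSpace
open Matrix Set

/-- Matrix-vector multiplication as a map on Euclidean space. -/
noncomputable def mvE {n : ℕ} (A : Matrix (Fin n) (Fin n) ℝ) (v : EuclideanSpace ℝ (Fin n)) :
    EuclideanSpace ℝ (Fin n) := Matrix.toEuclideanLin A v

/-- A real square matrix is Hurwitz if all its (complex) eigenvalues have negative real part. -/
def IsHurwitz {n : ℕ} (A : Matrix (Fin n) (Fin n) ℝ) : Prop :=
  ∀ μ ∈ spectrum ℂ (A.map Complex.ofReal), μ.re < 0

/-- The largest eigenvalue of a symmetric real matrix. -/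
noncomputable def eigMax {n : ℕ} {M : Matrix (Fin n) (Fin n) ℝ} (hM : M.IsHermitian) : ℝ :=
  ⨆ i, hM.eigenvalues i

/-- The smallest eigenvalue of a symmetric real matrix. -/
noncomputable def eigMin {n : ℕ} {M : Matrix (Fin n) (Fin n) ℝ} (hM : M.IsHermitian) : ℝ :=
  ⨅ i, hM.eigenvalues i

section Integrals

theorem sub_le_integral_of_hasDerivAt_le {f f' F : ℝ → ℝ} {a b : ℝ} (hab : a ≤ b)
    (hf : ∀ t, HasDerivAt f (f' t) t) (hF : Continuous F) (hle : ∀ t ∈ Icc a b, f' t ≤ F t) :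
    f b - f a ≤ ∫ τ in a..b, F τ :=
  intervalIntegral.sub_le_integral_of_hasDeriv_right_of_le hab
    (fun t _ => (hf t).continuousAt.continuousWithinAt) (fun t _ => (hf t).hasDerivWithinAt)
    hF.integrableOn_Icc (fun t ht => hle t (Ioo_subset_Icc_self ht))

theorem norm_sub_le_integral_of_hasDerivAt {E : Type*} [NormedAddCommGroup E] [NormedSpace ℝ E]
    {f f' : ℝ → E} {F : ℝ → ℝ} {a b : ℝ} (hab : a ≤ b) (hf : ∀ t, HasDerivAt f (f' t) t)
    (hF : Continuous F) (hle : ∀ t ∈ Icc a b, ‖f' t‖ ≤ F t) :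
    ‖f b - f a‖ ≤ ∫ τ in a..b, F τ := by
  refine image_norm_le_of_norm_deriv_right_le_deriv_boundary (a := a) (b := b)
    (f := fun t => f t - f a) (f' := f') (B := fun t => ∫ τ in a..t, F τ) (B' := F)
    ?_ ?_ ?_ ?_ ?_ (right_mem_Icc.2 hab)
  · exact fun t _ => ((hf t).sub_const _).continuousAt.continuousWithinAt
  · exact fun t _ => ((hf t).sub_const _).hasDerivWithinAt
  · simp
  · exact fun t => (hF.integral_hasStrictDerivAt a t).hasDerivAt
  · exact fun t ht => hle t (Ico_subset_Icc_self ht)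

theorem exists_mul_le_integral {f : ℝ → ℝ} (hf : Continuous f) {a h : ℝ} (hh : 0 ≤ h) :
    ∃ s ∈ Icc a (a + h), h * f s ≤ ∫ τ in a..(a + h), f τ := by
  obtain ⟨s, hs, hmin⟩ := isCompact_Icc.exists_isMinOn
    (nonempty_Icc.2 (by linarith : a ≤ a + h)) hf.continuousOn
  refine ⟨s, hs, ?_⟩
  have := intervalIntegral.integral_mono_on (μ := MeasureTheory.volume) (by linarith : a ≤ a + h)
    ((continuous_const (y := f s)).intervalIntegrable a (a + h))
    (hf.intervalIntegrable _ _) (fun t ht => hmin ht)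
  simpa using this

theorem integral_quadratic {f : ℝ → ℝ} (hf : Continuous f) (α β κ a b : ℝ) :
    ∫ τ in a..b, (α * f τ ^ 2 + β * f τ + κ) =
      α * (∫ τ in a..b, f τ ^ 2) + β * (∫ τ in a..b, f τ) + κ * (b - a) := by
  have h1 : Continuous fun τ => α * f τ ^ 2 := by fun_prop
  have h2 : Continuous fun τ => β * f τ := by fun_prop
  have h12 : Continuous fun τ => α * f τ ^ 2 + β * f τ := by fun_prop
  rw [intervalIntegral.integral_add (h12.intervalIntegrable _ _)
      (continuous_const.intervalIntegrable _ _),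
    intervalIntegral.integral_add (h1.intervalIntegrable _ _) (h2.intervalIntegrable _ _)]
  simp [mul_comm]

theorem integral_le_integral_of_subinterval {f : ℝ → ℝ} (hf : Continuous f) (h0 : ∀ t, 0 ≤ f t)
    {a b c d : ℝ} (hca : c ≤ a) (hab : a ≤ b) (hbd : b ≤ d) :
    ∫ τ in a..b, f τ ≤ ∫ τ in c..d, f τ :=
  intervalIntegral.integral_mono_interval hca hab hbd (Filter.Eventually.of_forall h0)
    (hf.intervalIntegrable _ _)

/-- A quadratic integral over a subinterval is bounded by the integrals over the full one. -/
theorem integral_quadratic_le {f : ℝ → ℝ} (hf : Continuous f) (h0 : ∀ t, 0 ≤ f t)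
    {α β κ a b c d I₁ I₂ : ℝ} (hα : 0 ≤ α) (hβ : 0 ≤ β) (hca : c ≤ a) (hab : a ≤ b) (hbd : b ≤ d)
    (h1 : ∫ τ in c..d, f τ ≤ I₁) (h2 : ∫ τ in c..d, f τ ^ 2 ≤ I₂) :
    ∫ τ in a..b, (α * f τ ^ 2 + β * f τ + κ) ≤ α * I₂ + β * I₁ + κ * (b - a) := by
  rw [integral_quadratic hf]
  have e1 := (integral_le_integral_of_subinterval hf h0 hca hab hbd).trans h1
  have e2 := (integral_le_integral_of_subinterval (hf.pow 2) (fun t => sq_nonneg _)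
    hca hab hbd).trans h2
  gcongr
  exact e2

theorem abs_integral_le_of_quadratic {f F : ℝ → ℝ} (hf : Continuous f) (h0 : ∀ t, 0 ≤ f t)
    {α β κ a b c d I₁ I₂ : ℝ} (hα : 0 ≤ α) (hβ : 0 ≤ β) (hca : c ≤ a) (hab : a ≤ b) (hbd : b ≤ d)
    (h1 : ∫ τ in c..d, f τ ≤ I₁) (h2 : ∫ τ in c..d, f τ ^ 2 ≤ I₂)
    (hF : ∀ t ∈ Icc a b, |F t| ≤ α * f t ^ 2 + β * f t + κ) :
    |∫ τ in a..b, F τ| ≤ α * I₂ + β * I₁ + κ * (b - a) := by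
  refine le_trans ?_ (integral_quadratic_le hf h0 hα hβ hca hab hbd h1 h2)
  rw [← Real.norm_eq_abs]
  refine intervalIntegral.norm_integral_le_of_norm_le hab
    (Filter.Eventually.of_forall fun t ht => hF t (Ioc_subset_Icc_self ht)) ?_
  exact Continuous.intervalIntegrable (by fun_prop) _ _

end Integrals

section AdaptiveLoop

variable {E : Type*} [NormedAddCommGroup E] [InnerProductSpace ℝ E]

theorem parameter_drift_le {e φ p : ℝ → E} {g c X T0 : ℝ} (hg : 0 ≤ g) (hX : 0 ≤ X)
    (hec : Continuous e) (hφ : ∀ t, HasDerivAt φ (p t) t)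
    (hp : ∀ t, 0 ≤ t → ‖p t‖ ≤ g * ‖e t‖ * (‖e t‖ + X)) {t s : ℝ} (ht : 0 ≤ t)
    (hts : t ≤ s) (hs : s ≤ t + T0)
    (h1 : ∫ τ in t..(t + T0), ‖e τ‖ ≤ c * T0) (h2 : ∫ τ in t..(t + T0), ‖e τ‖ ^ 2 ≤ c ^ 2 * T0) :
    ‖φ s - φ t‖ ≤ g * (c ^ 2 * T0) + g * X * (c * T0) := by
  have hn : Continuous fun τ => ‖e τ‖ := hec.norm
  have := norm_sub_le_integral_of_hasDerivAt (f := φ)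
    (F := fun τ => g * ‖e τ‖ ^ 2 + g * X * ‖e τ‖ + 0) hts hφ (by fun_prop)
    (fun τ hτ => (hp τ (ht.trans hτ.1)).trans (le_of_eq (by ring)))
  have h3 := integral_quadratic_le (κ := 0) hn (fun t => norm_nonneg _) hg (mul_nonneg hg hX)
    le_rfl hts hs h1 h2
  linarith

/-- Under persistent excitation, a tracking error that is small on average over a window forces
the parameter error to be bounded at the beginning of that window. -/
theorem exists_parameter_bound {e y φ p d : ℝ → E} {b : E} {a D g c X T0 δ0 ε0 : ℝ}
    (ha : 0 ≤ a) (hD : 0 ≤ D) (hg : 0 ≤ g) (hX : 0 ≤ X) (hc : 0 ≤ c) (hcε : c < ε0)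
    (hT0 : 0 < T0) (hδ0 : 0 < δ0)
    (he : ∀ t, HasDerivAt e (d t + ⟪φ t, e t + y t⟫ • b) t) (hd : ∀ t, ‖d t‖ ≤ a * ‖e t‖ + D)
    (hφ : ∀ t, HasDerivAt φ (p t) t)
    (hp : ∀ t, 0 ≤ t → ‖p t‖ ≤ g * ‖e t‖ * (‖e t‖ + X))
    (hy : Continuous y) (hyX : ∀ t, 0 ≤ t → ‖y t‖ ≤ X)
    (hPE : ∀ t : ℝ, 0 ≤ t → ∀ w : E, ‖w‖ = 1 →
      ∃ t2 : ℝ, t ≤ t2 ∧ t2 + δ0 ≤ t + T0 ∧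
        ε0 ≤ |(1 / T0) * ∫ τ in t2..(t2 + δ0), (⟪y τ, w⟫ : ℝ)|) :
    ∃ K, 0 ≤ K ∧ ∀ t, 0 ≤ t → ∫ τ in t..(t + T0), ‖e τ‖ ≤ c * T0 →
      ∫ τ in t..(t + T0), ‖e τ‖ ^ 2 ≤ c ^ 2 * T0 → ‖b‖ * ‖φ t‖ ≤ K := by
  have hec : Continuous e := continuous_iff_continuousAt.2 fun t => (he t).continuousAt
  have hφc : Continuous φ := continuous_iff_continuousAt.2 fun t => (hφ t).continuousAt
  have hn : Continuous fun τ => ‖e τ‖ := hec.norm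
  have hn0 : ∀ τ, 0 ≤ ‖e τ‖ := fun τ => norm_nonneg _
  set η := (ε0 - c) * T0 with hη
  have hηpos : 0 < η := mul_pos (by linarith) hT0
  set m := η / (8 * (c ^ 2 * T0 + 1)) with hm
  have hmpos : 0 < m := by positivity
  have hmle : m * (c ^ 2 * T0) ≤ η / 8 := by
    rw [hm, div_mul_eq_mul_div, div_le_div_iff₀ (by positivity) (by norm_num)]
    nlinarith
  set h := min (δ0 / 2) (η / (8 * (X + 1 / (4 * m)))) with hh
  have hXm : 0 < X + 1 / (4 * m) := by positivity
  have hhpos : 0 < h := lt_min (by linarith) (by positivity)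
  have hhδ : h ≤ δ0 / 2 := min_le_left _ _
  have hhη : (X + 1 / (4 * m)) * h ≤ η / 8 := by
    calc (X + 1 / (4 * m)) * h ≤ (X + 1 / (4 * m)) * (η / (8 * (X + 1 / (4 * m)))) := by
          gcongr; exact min_le_right _ _
      _ = η / 8 := by field_simp
  set C := g * (c ^ 2 * T0) + g * X * (c * T0) with hC
  have hC0 : 0 ≤ C := by positivity
  refine ⟨(2 * (c * T0 / h) + (a * (c * T0) + D * T0) + ‖b‖ * (C * (c * T0 + X * T0))) * (2 / η),
    by positivity, fun t ht h1 h2 => ?_⟩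
  rcases eq_or_ne (φ t) 0 with h0 | h0
  · rw [h0, norm_zero, mul_zero]; positivity
  set w : E := ‖φ t‖⁻¹ • φ t with hw
  have hΦ : 0 < ‖φ t‖ := norm_pos_iff.2 h0
  have hw1 : ‖w‖ = 1 := by
    rw [hw, norm_smul, norm_inv, norm_norm, inv_mul_cancel₀ hΦ.ne']
  have hφw : φ t = ‖φ t‖ • w := by
    rw [hw, smul_smul, mul_inv_cancel₀ hΦ.ne', one_smul]
  obtain ⟨t2, ht2, ht2', hexc⟩ := hPE t ht w hw1
  have hJ : ε0 * T0 ≤ |∫ τ in t2..(t2 + δ0), (⟪y τ, w⟫ : ℝ)| := by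
    rw [abs_mul, abs_of_pos (by positivity : 0 < 1 / T0)] at hexc
    calc ε0 * T0 ≤ _ := mul_le_mul_of_nonneg_right hexc hT0.le
      _ = _ := by field_simp
  have hxw : ∀ τ, |(⟪e τ, w⟫ : ℝ)| ≤ 0 * ‖e τ‖ ^ 2 + 1 * ‖e τ‖ + 0 := fun τ => by
    have := abs_real_inner_le_norm (e τ) w
    rw [hw1] at this
    linarith
  have hIe := abs_integral_le_of_quadratic hn hn0 le_rfl zero_le_one ht2
    (by linarith : t2 ≤ t2 + δ0) ht2' h1 h2 (fun τ _ => hxw τ)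
  have hcy : Continuous fun τ => (⟪y τ, w⟫ : ℝ) := by fun_prop
  have hce : Continuous fun τ => (⟪e τ, w⟫ : ℝ) := by fun_prop
  have hcx : Continuous fun τ => (⟪e τ + y τ, w⟫ : ℝ) := by fun_prop
  have hIx : η ≤ |∫ τ in t2..(t2 + δ0), (⟪e τ + y τ, w⟫ : ℝ)| := by
    have : ∫ τ in t2..(t2 + δ0), (⟪e τ + y τ, w⟫ : ℝ) =
        (∫ τ in t2..(t2 + δ0), (⟪e τ, w⟫ : ℝ)) + ∫ τ in t2..(t2 + δ0), (⟪y τ, w⟫ : ℝ) := by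
      rw [← intervalIntegral.integral_add (hce.intervalIntegrable _ _) (hcy.intervalIntegrable _ _)]
      simp only [inner_add_left]
    rw [this]
    have h3 := abs_sub_abs_le_abs_sub (∫ τ in t2..(t2 + δ0), (⟪y τ, w⟫ : ℝ))
      (-∫ τ in t2..(t2 + δ0), (⟪e τ, w⟫ : ℝ))
    rw [abs_neg, sub_neg_eq_add, add_comm (∫ τ in t2..(t2 + δ0), (⟪y τ, w⟫ : ℝ))] at h3
    rw [hη]
    linarith
  obtain ⟨s1, hs1, hes1⟩ := exists_mul_le_integral hn (a := t2) hhpos.le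
  obtain ⟨s2, hs2, hes2⟩ := exists_mul_le_integral hn (a := t2 + δ0 - h) hhpos.le
  rw [sub_add_cancel] at hes2 hs2
  obtain ⟨hs1a, hs1b⟩ := hs1
  obtain ⟨hs2a, hs2b⟩ := hs2
  have hs12 : s1 ≤ s2 := by linarith
  have hes1' : ‖e s1‖ ≤ c * T0 / h := by
    rw [le_div_iff₀ hhpos, mul_comm]
    exact hes1.trans ((integral_le_integral_of_subinterval hn hn0 ht2 (by linarith)
      (by linarith)).trans h1)
  have hes2' : ‖e s2‖ ≤ c * T0 / h := by
    rw [le_div_iff₀ hhpos, mul_comm]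
    exact hes2.trans ((integral_le_integral_of_subinterval hn hn0 (by linarith) (by linarith)
      (by linarith)).trans h1)
  have hshort : ∀ a b, t ≤ a → a ≤ b → b ≤ t + T0 → b - a ≤ h →
      |∫ τ in a..b, (⟪e τ + y τ, w⟫ : ℝ)| ≤ η / 4 := by
    intro a b hta hab hbt hba
    have := abs_integral_le_of_quadratic (F := fun τ => (⟪e τ + y τ, w⟫ : ℝ)) (κ := X + 1 / (4 * m))
      hn hn0 hmpos.le le_rfl hta hab hbt h1 h2 (fun τ hτ => by
        have h3 := abs_real_inner_le_norm (e τ + y τ) w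
        rw [hw1, mul_one] at h3
        have h4 := norm_add_le (e τ) (y τ)
        have h5 := hyX τ (by linarith [hτ.1])
        have h6 : ‖e τ‖ ≤ m * ‖e τ‖ ^ 2 + 1 / (4 * m) := by
          have : m * ‖e τ‖ ^ 2 + 1 / (4 * m) - ‖e τ‖ = m * (‖e τ‖ - 1 / (2 * m)) ^ 2 := by
            field_simp; ring
          have : 0 ≤ m * (‖e τ‖ - 1 / (2 * m)) ^ 2 := by positivity
          linarith
        linarith)
    have h7 : (X + 1 / (4 * m)) * (b - a) ≤ (X + 1 / (4 * m)) * h := by gcongr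
    linarith
  have hIx' : η / 2 ≤ |∫ τ in s1..s2, (⟪e τ + y τ, w⟫ : ℝ)| := by
    have e1 := hshort t2 s1 ht2 hs1a (by linarith) (by linarith)
    have e2 := hshort s2 (t2 + δ0) (by linarith) hs2b (by linarith) (by linarith)
    have e3 := intervalIntegral.integral_add_adjacent_intervals
      (hcx.intervalIntegrable (μ := MeasureTheory.volume) t2 s1) (hcx.intervalIntegrable s1 s2)
    have e4 := intervalIntegral.integral_add_adjacent_intervals
      (hcx.intervalIntegrable (μ := MeasureTheory.volume) t2 s2)
      (hcx.intervalIntegrable s2 (t2 + δ0))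
    rw [← e4, ← e3] at hIx
    have e5 := abs_add_three (∫ τ in t2..s1, (⟪e τ + y τ, w⟫ : ℝ))
      (∫ τ in s1..s2, (⟪e τ + y τ, w⟫ : ℝ)) (∫ τ in s2..(t2 + δ0), (⟪e τ + y τ, w⟫ : ℝ))
    linarith
  have hcφx : Continuous fun τ => (⟪φ τ, e τ + y τ⟫ : ℝ) := by fun_prop
  have hcψx : Continuous fun τ => (⟪φ τ - φ t, e τ + y τ⟫ : ℝ) := by fun_prop
  have hdrift : |∫ τ in s1..s2, (⟪φ τ - φ t, e τ + y τ⟫ : ℝ)| ≤ C * (c * T0 + X * T0) := by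
    have := abs_integral_le_of_quadratic (F := fun τ => (⟪φ τ - φ t, e τ + y τ⟫ : ℝ))
      (κ := C * X) hn hn0 le_rfl hC0 (by linarith : t ≤ s1) hs12
      (by linarith : s2 ≤ t + T0) h1 h2 (fun τ hτ => by
        have h3 := abs_real_inner_le_norm (φ τ - φ t) (e τ + y τ)
        have h4 := norm_add_le (e τ) (y τ)
        have h5 := hyX τ (by linarith [hτ.1])
        have h6 := parameter_drift_le hg hX hec hφ hp ht (by linarith [hτ.1] : t ≤ τ)
          (by linarith [hτ.2]) h1 h2
        have h7 : ‖φ τ - φ t‖ * ‖e τ + y τ‖ ≤ C * (‖e τ‖ + X) :=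
          mul_le_mul h6 (by linarith) (norm_nonneg _) hC0
        linarith)
    have h8 : C * X * (s2 - s1) ≤ C * X * T0 := by
      gcongr; linarith
    linarith
  have hIφ : ‖φ t‖ * (η / 2) - C * (c * T0 + X * T0) ≤
      |∫ τ in s1..s2, (⟪φ τ, e τ + y τ⟫ : ℝ)| := by
    have e1 : ∫ τ in s1..s2, (⟪φ τ, e τ + y τ⟫ : ℝ) =
        ‖φ t‖ * (∫ τ in s1..s2, (⟪e τ + y τ, w⟫ : ℝ)) +
          ∫ τ in s1..s2, (⟪φ τ - φ t, e τ + y τ⟫ : ℝ) := by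
      rw [← intervalIntegral.integral_const_mul, ← intervalIntegral.integral_add
        ((hcx.const_mul _).intervalIntegrable _ _) (hcψx.intervalIntegrable _ _)]
      congr 1
      ext τ
      have : ‖φ t‖ * (⟪e τ + y τ, w⟫ : ℝ) = ⟪φ t, e τ + y τ⟫ := by
        conv_rhs => rw [hφw, real_inner_smul_left, real_inner_comm]
      rw [this, inner_sub_left]
      ring
    have e2 : ‖φ t‖ * (η / 2) ≤ |‖φ t‖ * (∫ τ in s1..s2, (⟪e τ + y τ, w⟫ : ℝ))| := by
      rw [abs_mul, abs_norm]
      gcongr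
    rw [e1]
    have e3 := abs_sub_abs_le_abs_sub (‖φ t‖ * (∫ τ in s1..s2, (⟪e τ + y τ, w⟫ : ℝ)))
      (-∫ τ in s1..s2, (⟪φ τ - φ t, e τ + y τ⟫ : ℝ))
    rw [abs_neg, sub_neg_eq_add] at e3
    linarith
  have hstep : |∫ τ in s1..s2, (⟪φ τ, e τ + y τ⟫ : ℝ)| * ‖b‖ ≤
      2 * (c * T0 / h) + (a * (c * T0) + D * T0) := by
    have hder : ∀ s, HasDerivAt (fun s => e s - (∫ τ in s1..s, (⟪φ τ, e τ + y τ⟫ : ℝ)) • b)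
        (d s) s := fun s => by
      have e1 := (hcφx.integral_hasStrictDerivAt s1 s).hasDerivAt
      simpa using (he s).fun_sub (e1.smul_const b)
    have e2 := norm_sub_le_integral_of_hasDerivAt (F := fun τ => 0 * ‖e τ‖ ^ 2 + a * ‖e τ‖ + D)
      hs12 hder (by fun_prop) (fun τ _ => (hd τ).trans (by linarith))
    have e3 := e2.trans (integral_quadratic_le hn hn0 le_rfl ha (by linarith : t ≤ s1) hs12
      (by linarith : s2 ≤ t + T0) h1 h2)
    have e4 : D * (s2 - s1) ≤ D * T0 := by gcongr; linarith
    simp only [intervalIntegral.integral_same, zero_smul, sub_zero] at e3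
    rw [← Real.norm_eq_abs, ← norm_smul]
    set Y := (∫ τ in s1..s2, (⟪φ τ, e τ + y τ⟫ : ℝ)) • b
    have e5 : ‖Y‖ ≤ ‖e s2‖ + ‖e s1‖ + ‖e s2 - Y - e s1‖ := by
      have : Y = e s2 - e s1 - (e s2 - Y - e s1) := by abel
      calc ‖Y‖ = ‖e s2 - e s1 - (e s2 - Y - e s1)‖ := by rw [← this]
        _ ≤ ‖e s2 - e s1‖ + ‖e s2 - Y - e s1‖ := norm_sub_le _ _
        _ ≤ _ := by gcongr; exact norm_sub_le _ _
    linarith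
  have hfin : (‖φ t‖ * (η / 2) - C * (c * T0 + X * T0)) * ‖b‖ ≤
      2 * (c * T0 / h) + (a * (c * T0) + D * T0) :=
    (mul_le_mul_of_nonneg_right hIφ (norm_nonneg b)).trans hstep
  rw [mul_div_assoc', le_div_iff₀ hηpos]
  linarith


/-- The Lyapunov function of the adaptive loop cannot grow beyond a fixed level: over each window
it either does not increase, or the tracking and parameter errors are bounded at some instant. -/
theorem exists_lyapunov_bound {V V' : ℝ → ℝ} {e φ p : ℝ → E} {g c X T0 q M Φ : ℝ}
    (hg : 0 ≤ g) (hX : 0 ≤ X) (hc : 0 ≤ c) (hT0 : 0 < T0) (hq : 0 < q) (hM : 0 ≤ M)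
    (hec : Continuous e) (hφ : ∀ t, HasDerivAt φ (p t) t)
    (hp : ∀ t, 0 ≤ t → ‖p t‖ ≤ g * ‖e t‖ * (‖e t‖ + X))
    (hV : ∀ t, HasDerivAt V (V' t) t) (hV' : ∀ t, V' t ≤ q * (c * ‖e t‖ - ‖e t‖ ^ 2))
    (hVM : ∀ t, V t ≤ M * (‖e t‖ ^ 2 + ‖φ t‖ ^ 2))
    (hΦ : ∀ t, 0 ≤ t → ∫ τ in t..(t + T0), ‖e τ‖ ≤ c * T0 →
      ∫ τ in t..(t + T0), ‖e τ‖ ^ 2 ≤ c ^ 2 * T0 → ‖φ t‖ ≤ Φ) :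
    ∃ B, ∀ t, 0 ≤ t → V t ≤ B := by
  have hn : Continuous fun τ => ‖e τ‖ := hec.norm
  set C := g * (c ^ 2 * T0) + g * X * (c * T0) with hC
  set G := q * c ^ 2 * T0 with hG
  have hgrow : ∀ t s, t ≤ s → s ≤ t + T0 → V s ≤ V t + G := by
    intro t s hts hs
    have h1 := sub_le_integral_of_hasDerivAt_le (F := fun _ => q * c ^ 2) hts hV continuous_const
      (fun τ _ => (hV' τ).trans (by
        gcongr
        nlinarith [sq_nonneg (‖e τ‖ - c), norm_nonneg (e τ), mul_nonneg hc (norm_nonneg (e τ))]))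
    rw [intervalIntegral.integral_const, smul_eq_mul] at h1
    have h2 : (s - t) * (q * c ^ 2) ≤ T0 * (q * c ^ 2) := by gcongr; linarith
    rw [hG]
    linarith
  set W := M * (c ^ 2 + (Φ + C) ^ 2) + G with hW
  have hstep : ∀ t, 0 ≤ t → V (t + T0) ≤ max (V t) W := by
    intro t ht
    by_cases hle : V (t + T0) ≤ V t
    · exact hle.trans (le_max_left _ _)
    push Not at hle
    refine le_trans ?_ (le_max_right _ _)
    have h1 := sub_le_integral_of_hasDerivAt_le
      (F := fun τ => -q * ‖e τ‖ ^ 2 + q * c * ‖e τ‖ + 0)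
      (by linarith : t ≤ t + T0) hV (by fun_prop) (fun τ _ => (hV' τ).trans (by linarith))
    rw [integral_quadratic hn] at h1
    set I₁ := ∫ τ in t..(t + T0), ‖e τ‖ with hI₁
    set I₂ := ∫ τ in t..(t + T0), ‖e τ‖ ^ 2 with hI₂
    have hI : I₂ < c * I₁ := by
      have : 0 < q * (c * I₁ - I₂) := by linarith
      have := (mul_pos_iff_of_pos_left hq).1 this
      linarith
    have hsq : 0 ≤ I₂ - 2 * c * I₁ + c ^ 2 * T0 := by
      have h2 := integral_quadratic hn 1 (-(2 * c)) (c ^ 2) t (t + T0)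
      have h3 : 0 ≤ ∫ τ in t..(t + T0), (1 * ‖e τ‖ ^ 2 + -(2 * c) * ‖e τ‖ + c ^ 2) :=
        intervalIntegral.integral_nonneg (by linarith) fun τ _ => by
          nlinarith [sq_nonneg (‖e τ‖ - c)]
      rw [h2] at h3
      linarith
    have hI₂0 : 0 ≤ I₂ := intervalIntegral.integral_nonneg (by linarith) fun τ _ => sq_nonneg _
    have hcpos : 0 < c := by
      rcases hc.eq_or_lt with h | h
      · rw [← h] at hI; linarith
      · exact h
    have hb1 : I₁ ≤ c * T0 := by
      have : c * I₁ ≤ c * (c * T0) := by linarith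
      exact le_of_mul_le_mul_left this hcpos
    have hb2 : I₂ ≤ c ^ 2 * T0 := by linarith
    have hφt := hΦ t ht hb1 hb2
    obtain ⟨s, hs, hes⟩ := exists_mul_le_integral hn (a := t) hT0.le
    have hes' : ‖e s‖ ≤ c := by
      refine le_of_mul_le_mul_left ?_ hT0
      linarith
    have hφs : ‖φ s‖ ≤ Φ + C := by
      have h4 := parameter_drift_le hg hX hec hφ hp ht hs.1 hs.2 hb1 hb2
      have h5 := norm_le_norm_add_norm_sub' (φ s) (φ t)
      linarith
    have h6 : V s ≤ M * (c ^ 2 + (Φ + C) ^ 2) := (hVM s).trans (by gcongr)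
    have h7 := hgrow s (t + T0) hs.2 (by linarith [hs.1])
    linarith
  refine ⟨max (V 0 + G) W, fun t ht => ?_⟩
  have key : ∀ n : ℕ, ∀ s, 0 ≤ s → s ≤ T0 → V (s + n * T0) ≤ max (V 0 + G) W := by
    intro n
    induction n with
    | zero =>
      intro s h0 hs
      refine le_trans ?_ (le_max_left _ _)
      simpa using hgrow 0 s h0 (by linarith)
    | succ n ih =>
      intro s h0 hs
      have h8 := hstep (s + n * T0) (by positivity)
      have : s + (n + 1 : ℕ) * T0 = s + n * T0 + T0 := by push_cast; ring
      rw [this]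
      exact h8.trans (max_le (ih s h0 hs) (le_max_right _ _))
  have hfl := Nat.floor_le (div_nonneg ht hT0.le)
  have hfu := Nat.lt_floor_add_one (t / T0)
  rw [le_div_iff₀ hT0] at hfl
  rw [div_lt_iff₀ hT0] at hfu
  have := key ⌊t / T0⌋₊ (t - ⌊t / T0⌋₊ * T0) (by linarith) (by linarith)
  rwa [sub_add_cancel] at this

theorem hasDerivAt_inner_self_clm {L : E →L[ℝ] E} (hL : ∀ x y, ⟪L x, y⟫ = ⟪x, L y⟫)
    {f : ℝ → E} {f' : E} {t : ℝ} (hf : HasDerivAt f f' t) :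
    HasDerivAt (fun s => ⟪f s, L (f s)⟫) (2 * ⟪f', L (f t)⟫) t := by
  have h := hf.inner ℝ (L.hasFDerivAt.comp_hasDerivAt t hf)
  have hs : (⟪f t, L f'⟫ : ℝ) = ⟪f', L (f t)⟫ := by rw [← hL, real_inner_comm]
  rw [hs, Function.comp, ← two_mul] at h
  exact h

end AdaptiveLoop

theorem exists_bound_of_hasDerivAt_le {f f' : ℝ → ℝ} {α K : ℝ} (hα : 0 < α)
    (hf : ∀ t, HasDerivAt f (f' t) t) (hle : ∀ t, f' t ≤ -α * f t + K) :
    ∃ B, ∀ t, 0 ≤ t → f t ≤ B := by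
  have hder : ∀ t, HasDerivAt (fun s => Real.exp (α * s) * (f s - K / α))
      (Real.exp (α * t) * (α * (f t - K / α) + f' t)) t := fun t => by
    have h1 : HasDerivAt (fun s => Real.exp (α * s)) (Real.exp (α * t) * α) t := by
      simpa using ((hasDerivAt_id t).const_mul α).exp
    convert! h1.mul ((hf t).sub_const (K / α)) using 1
    ring
  have hanti : Antitone fun s => Real.exp (α * s) * (f s - K / α) :=
    antitone_of_hasDerivAt_nonpos hder fun t =>
      mul_nonpos_of_nonneg_of_nonpos (Real.exp_pos _).le (by
        have := hle t
        have h2 : α * (f t - K / α) = α * f t - K := by field_simp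
        linarith)
  refine ⟨|f 0 - K / α| + K / α, fun t ht => ?_⟩
  have h3 : Real.exp (α * t) * (f t - K / α) ≤ f 0 - K / α := by simpa using hanti ht
  have h4 : 1 ≤ Real.exp (α * t) := Real.one_le_exp (by positivity)
  rcases le_or_gt (f t - K / α) 0 with h5 | h5
  · linarith [abs_nonneg (f 0 - K / α)]
  · have := le_abs_self (f 0 - K / α)
    nlinarith

section EuclideanMatrix

variable {n : ℕ}

theorem mvE_add (A B : Matrix (Fin n) (Fin n) ℝ) (x : EuclideanSpace ℝ (Fin n)) :
    mvE (A + B) x = mvE A x + mvE B x := by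
  simp [mvE]

theorem mvE_neg (A : Matrix (Fin n) (Fin n) ℝ) (x : EuclideanSpace ℝ (Fin n)) :
    mvE (-A) x = -mvE A x := by
  simp [mvE]

theorem mvE_mul (A B : Matrix (Fin n) (Fin n) ℝ) (x : EuclideanSpace ℝ (Fin n)) :
    mvE (A * B) x = mvE A (mvE B x) := by
  simp [mvE, Matrix.toLpLin_apply]

theorem mvE_vecMulVec (b k x : EuclideanSpace ℝ (Fin n)) :
    mvE (Matrix.vecMulVec b k) x = ⟪k, x⟫ • b := by
  ext i
  simp [mvE, Matrix.toLpLin_apply, Matrix.vecMulVec_mulVec,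
    EuclideanSpace.inner_eq_star_dotProduct, dotProduct_comm]

theorem inner_mvE_left (A : Matrix (Fin n) (Fin n) ℝ) (x y : EuclideanSpace ℝ (Fin n)) :
    ⟪mvE A x, y⟫ = ⟪x, mvE Aᵀ y⟫ := by
  simp only [mvE, Matrix.toLpLin_apply, EuclideanSpace.inner_eq_star_dotProduct, star_trivial]
  rw [Matrix.mulVec_transpose, ← Matrix.dotProduct_mulVec]

/-- Multiplication by a matrix as a continuous linear map on Euclidean space. -/
noncomputable def mvCLM (A : Matrix (Fin n) (Fin n) ℝ) :
    EuclideanSpace ℝ (Fin n) →L[ℝ] EuclideanSpace ℝ (Fin n) :=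
  (Matrix.toEuclideanLin A).toContinuousLinearMap

@[simp]
theorem mvCLM_apply (A : Matrix (Fin n) (Fin n) ℝ) (x : EuclideanSpace ℝ (Fin n)) :
    mvCLM A x = mvE A x := rfl

theorem inner_eigenvectorBasis_mvE {M : Matrix (Fin n) (Fin n) ℝ} (hM : M.IsHermitian)
    (x : EuclideanSpace ℝ (Fin n)) (i : Fin n) :
    ⟪hM.eigenvectorBasis i, mvE M x⟫ = hM.eigenvalues i * ⟪hM.eigenvectorBasis i, x⟫ := by
  have h : mvE M (hM.eigenvectorBasis i) = hM.eigenvalues i • hM.eigenvectorBasis i := by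
    ext j
    simpa [mvE, Matrix.toLpLin_apply] using congrFun (hM.mulVec_eigenvectorBasis i) j
  have hT : Mᵀ = M := (Matrix.conjTranspose_eq_transpose_of_trivial M).symm.trans hM
  have h2 := inner_mvE_left M (hM.eigenvectorBasis i) x
  rw [hT, h, real_inner_smul_left] at h2
  exact h2.symm

theorem eigMin_mul_sq_le {M : Matrix (Fin n) (Fin n) ℝ} (hM : M.IsHermitian)
    (x : EuclideanSpace ℝ (Fin n)) : eigMin hM * ‖x‖ ^ 2 ≤ ⟪x, mvE M x⟫ := by
  rw [← hM.eigenvectorBasis.sum_inner_mul_inner x (mvE M x),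
    ← hM.eigenvectorBasis.sum_sq_inner_right x, Finset.mul_sum]
  refine Finset.sum_le_sum fun i _ => ?_
  rw [inner_eigenvectorBasis_mvE, real_inner_comm x]
  have : eigMin hM ≤ hM.eigenvalues i := ciInf_le (Set.finite_range _).bddBelow i
  nlinarith [sq_nonneg (⟪hM.eigenvectorBasis i, x⟫ : ℝ)]

theorem norm_mvE_le_eigMax {M : Matrix (Fin n) (Fin n) ℝ} (hM : M.PosDef)
    (x : EuclideanSpace ℝ (Fin n)) : ‖mvE M x‖ ≤ eigMax hM.1 * ‖x‖ := by
  have h0 : 0 ≤ eigMax hM.1 := Real.iSup_nonneg fun i => (hM.eigenvalues_pos i).le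
  refine (sq_le_sq₀ (norm_nonneg _) (by positivity)).1 ?_
  rw [mul_pow, ← hM.1.eigenvectorBasis.sum_sq_inner_right (mvE M x),
    ← hM.1.eigenvectorBasis.sum_sq_inner_right x, Finset.mul_sum]
  refine Finset.sum_le_sum fun i _ => ?_
  rw [inner_eigenvectorBasis_mvE, mul_pow]
  have : hM.1.eigenvalues i ≤ eigMax hM.1 := le_ciSup (Set.finite_range _).bddAbove i
  have := (hM.eigenvalues_pos i).le
  gcongr

theorem eigMin_pos [NeZero n] {M : Matrix (Fin n) (Fin n) ℝ} (hM : M.PosDef) :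
    0 < eigMin hM.1 := by
  obtain ⟨i, hi⟩ := exists_eq_ciInf_of_finite (f := hM.1.eigenvalues)
  rw [eigMin, ← hi]
  exact hM.eigenvalues_pos i

theorem lyapunov_identity {Am P Q : Matrix (Fin n) (Fin n) ℝ} (hP : Pᵀ = P)
    (hLyap : Amᵀ * P + P * Am = -Q) (x : EuclideanSpace ℝ (Fin n)) :
    2 * ⟪mvE Am x, mvE P x⟫ = -⟪x, mvE Q x⟫ := by
  have h1 : ⟪x, mvE (Amᵀ * P + P * Am) x⟫ = -(⟪x, mvE Q x⟫ : ℝ) := by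
    rw [hLyap, mvE_neg, inner_neg_right]
  rw [mvE_add, inner_add_right, mvE_mul, mvE_mul, ← inner_mvE_left] at h1
  have h2 := inner_mvE_left P x (mvE Am x)
  rw [hP, real_inner_comm] at h2
  linarith

/-- The state of the reference model driven by a bounded reference input is bounded. -/
theorem reference_state_bounded [NeZero n] {Am P Q : Matrix (Fin n) (Fin n) ℝ}
    (hP : P.PosDef) (hQ : Q.PosDef) (hLyap : Amᵀ * P + P * Am = -Q)
    {b : EuclideanSpace ℝ (Fin n)} {r : ℝ → ℝ} (hr : ∃ R : ℝ, ∀ t, |r t| ≤ R)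
    {xm : ℝ → EuclideanSpace ℝ (Fin n)}
    (hxm : ∀ t : ℝ, HasDerivAt xm (mvE Am (xm t) + r t • b) t) :
    ∃ X, 0 ≤ X ∧ ∀ t, 0 ≤ t → ‖xm t‖ ≤ X := by
  obtain ⟨R, hR⟩ := hr
  have hR0 : 0 ≤ R := (abs_nonneg _).trans (hR 0)
  have hPT : Pᵀ = P := (Matrix.conjTranspose_eq_transpose_of_trivial P).symm.trans hP.1
  have hPs : ∀ y z : EuclideanSpace ℝ (Fin n), ⟪mvCLM P y, z⟫ = ⟪y, mvCLM P z⟫ := fun y z => by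
    simp only [mvCLM_apply]
    rw [inner_mvE_left, hPT]
  have hq : 0 < eigMin hQ.1 := eigMin_pos hQ
  have hl : 0 < eigMin hP.1 := eigMin_pos hP
  have hL : 0 < eigMax hP.1 :=
    hl.trans_le ((ciInf_le (Set.finite_range _).bddBelow (0 : Fin n)).trans
      (le_ciSup (Set.finite_range _).bddAbove (0 : Fin n)))
  set q := eigMin hQ.1
  set L := eigMax hP.1
  set S := R * ‖b‖ * L with hS
  obtain ⟨B, hB⟩ := exists_bound_of_hasDerivAt_le (α := q / (2 * L)) (K := 2 * S ^ 2 / q)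
    (by positivity) (fun t => hasDerivAt_inner_self_clm hPs (hxm t)) (fun t => by
      simp only [mvCLM_apply]
      rw [inner_add_left, mul_add, lyapunov_identity hPT hLyap]
      have h1 := eigMin_mul_sq_le hQ.1 (xm t)
      have h2 : ⟪r t • b, mvE P (xm t)⟫ ≤ S * ‖xm t‖ := by
        refine (real_inner_le_norm _ _).trans ?_
        rw [norm_smul, hS, mul_assoc (R * ‖b‖)]
        exact mul_le_mul (mul_le_mul_of_nonneg_right (hR t) (norm_nonneg b))
          (norm_mvE_le_eigMax hP _) (norm_nonneg _) (by positivity)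
      have h3 : ⟪xm t, mvE P (xm t)⟫ ≤ L * ‖xm t‖ ^ 2 := by
        have h4 := real_inner_le_norm (xm t) (mvE P (xm t))
        have h5 := mul_le_mul_of_nonneg_left (norm_mvE_le_eigMax hP (xm t)) (norm_nonneg (xm t))
        linarith
      have h6 : q / (2 * L) * ⟪xm t, mvE P (xm t)⟫ ≤ q / 2 * ‖xm t‖ ^ 2 := by
        calc q / (2 * L) * ⟪xm t, mvE P (xm t)⟫ ≤ q / (2 * L) * (L * ‖xm t‖ ^ 2) := by gcongr
          _ = q / 2 * ‖xm t‖ ^ 2 := by field_simp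
      have h7 : q / 2 * ‖xm t‖ ^ 2 - 2 * S * ‖xm t‖ + 2 * S ^ 2 / q =
          q / 2 * (‖xm t‖ - 2 * S / q) ^ 2 := by
        field_simp
        ring
      have h8 : 0 ≤ q / 2 * (‖xm t‖ - 2 * S / q) ^ 2 := by positivity
      linarith)
  refine ⟨√(B / eigMin hP.1), Real.sqrt_nonneg _, fun t ht => ?_⟩
  refine Real.le_sqrt_of_sq_le ?_
  rw [le_div_iff₀ hl]
  have h9 := hB t ht
  have h10 := eigMin_mul_sq_le hP.1 (xm t)
  rw [mvCLM_apply] at h9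
  linarith

end EuclideanMatrix

/-- **Robustness of adaptive control to bounded disturbances under persistent
excitation.** Plant `ẋ = Ax + bu + v` with `‖v(t)‖ ≤ v_max`; control `u = kᵀx + r`;
matching `A + bk*ᵀ = Aₘ` (`Aₘ` Hurwitz); reference model `ẋₘ = Aₘxₘ + br`; adaptive law
`k̇ = −γ(eᵀPb)x` with `AₘᵀP + PAₘ = −Q`, `P,Q ≻ 0`. If `xₘ` is persistently exciting
with level `ε₀` (constants `T₀, δ₀`), and `ε₀ > k₀ v_max` with
`k₀ = 2λ_max(P)/λ_min(Q)`, then all solutions `(e(t), k(t))` are globally bounded. -/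
theorem adaptive_control_PE_robustness_bounded_disturbance
    (n : ℕ) (A Am : Matrix (Fin n) (Fin n) ℝ) (b : EuclideanSpace ℝ (Fin n))
    (kstar : EuclideanSpace ℝ (Fin n))
    (hmatch : A + Matrix.vecMulVec b kstar = Am) (hAm : IsHurwitz Am)
    (P Q : Matrix (Fin n) (Fin n) ℝ) (hP : P.PosDef) (hQ : Q.PosDef)
    (hLyap : Amᵀ * P + P * Am = -Q)
    (γ : ℝ) (hγ : 0 < γ)
    (v : ℝ → EuclideanSpace ℝ (Fin n)) (vmax : ℝ) (hv : ∀ t, ‖v t‖ ≤ vmax)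
    (r : ℝ → ℝ) (hr : ∃ R : ℝ, ∀ t, |r t| ≤ R) (u : ℝ → ℝ)
    (x xm k : ℝ → EuclideanSpace ℝ (Fin n))
    (hu : ∀ t, u t = ⟪k t, x t⟫ + r t)
    (hx : ∀ t : ℝ, HasDerivAt x (mvE A (x t) + u t • b + v t) t)
    (hxm : ∀ t : ℝ, HasDerivAt xm (mvE Am (xm t) + r t • b) t)
    (hk : ∀ t : ℝ, HasDerivAt k ((-(γ * ⟪x t - xm t, mvE P b⟫)) • x t) t)
    (T0 δ0 ε0 : ℝ) (hT0 : 0 < T0) (hδ0 : 0 < δ0) (hε0 : 0 < ε0)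
    (hPE : ∀ t : ℝ, 0 ≤ t → ∀ w : EuclideanSpace ℝ (Fin n), ‖w‖ = 1 →
      ∃ t2 : ℝ, t ≤ t2 ∧ t2 + δ0 ≤ t + T0 ∧
        ε0 ≤ |(1 / T0) * ∫ τ in t2..(t2 + δ0), (⟪xm τ, w⟫ : ℝ)|)
    (hlevel : (2 * eigMax hP.1 / eigMin hQ.1) * vmax < ε0) :
    ∃ M : ℝ, ∀ t : ℝ, 0 ≤ t → ‖x t - xm t‖ ≤ M ∧ ‖k t‖ ≤ M := by
  rcases Nat.eq_zero_or_pos n with rfl | hn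
  · exact ⟨0, fun t _ => by simp [Subsingleton.elim (x t - xm t) 0, Subsingleton.elim (k t) 0]⟩
  have : NeZero n := ⟨hn.ne'⟩
  have hPT : Pᵀ = P := (Matrix.conjTranspose_eq_transpose_of_trivial P).symm.trans hP.1
  have hPs : ∀ y z : EuclideanSpace ℝ (Fin n), ⟪mvE P y, z⟫ = ⟪y, mvE P z⟫ := fun y z => by
    rw [inner_mvE_left, hPT]
  have hvmax : 0 ≤ vmax := (norm_nonneg _).trans (hv 0)
  have hq : 0 < eigMin hQ.1 := eigMin_pos hQ
  have hl : 0 < eigMin hP.1 := eigMin_pos hP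
  have hL : 0 ≤ eigMax hP.1 := Real.iSup_nonneg fun i => (hP.eigenvalues_pos i).le
  have hPup : ∀ y : EuclideanSpace ℝ (Fin n), ⟪y, mvE P y⟫ ≤ eigMax hP.1 * ‖y‖ ^ 2 := fun y => by
    have h1 := real_inner_le_norm y (mvE P y)
    have h2 := mul_le_mul_of_nonneg_left (norm_mvE_le_eigMax hP y) (norm_nonneg y)
    linarith
  obtain ⟨X, hX0, hX⟩ := reference_state_bounded hP hQ hLyap hr hxm
  have hc : 0 ≤ 2 * eigMax hP.1 / eigMin hQ.1 * vmax := by positivity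
  set c := 2 * eigMax hP.1 / eigMin hQ.1 * vmax with hcdef
  have hqc : eigMin hQ.1 * c = 2 * eigMax hP.1 * vmax := by
    rw [hcdef]; field_simp
  set e : ℝ → EuclideanSpace ℝ (Fin n) := fun t => x t - xm t with hedef
  set φ : ℝ → EuclideanSpace ℝ (Fin n) := fun t => k t - kstar with hφdef
  set p : ℝ → EuclideanSpace ℝ (Fin n) := fun t => (-(γ * ⟪e t, mvE P b⟫)) • x t with hpdef
  have hsum : ∀ t, e t + xm t = x t := fun t => sub_add_cancel _ _
  have he : ∀ t, HasDerivAt e ((mvE Am (e t) + v t) + ⟪φ t, e t + xm t⟫ • b) t := fun t => by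
    refine ((hx t).sub (hxm t)).congr_deriv ?_
    have h1 : mvE Am (e t) = mvE Am (x t) - mvE Am (xm t) := by simp [hedef, mvE]
    have h2 : mvE Am (x t) = mvE A (x t) + ⟪kstar, x t⟫ • b := by
      rw [← hmatch, mvE_add, mvE_vecMulVec]
    rw [hsum, h1, h2, hu, hφdef, inner_sub_left]
    module
  have hφ : ∀ t, HasDerivAt φ (p t) t := fun t => (hk t).sub_const kstar
  have hxm_cont : Continuous xm := continuous_iff_continuousAt.2 fun t => (hxm t).continuousAt
  have hec : Continuous e := continuous_iff_continuousAt.2 fun t => (he t).continuousAt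
  have hg : 0 ≤ γ * ‖mvE P b‖ := by positivity
  have hp : ∀ t, 0 ≤ t → ‖p t‖ ≤ γ * ‖mvE P b‖ * ‖e t‖ * (‖e t‖ + X) := fun t ht => by
    rw [hpdef, norm_smul, norm_neg, norm_mul, Real.norm_of_nonneg hγ.le]
    have h1 : ‖(⟪e t, mvE P b⟫ : ℝ)‖ ≤ ‖e t‖ * ‖mvE P b‖ := norm_inner_le_norm _ _
    have h2 : ‖x t‖ ≤ ‖e t‖ + X := by
      rw [← hsum t]
      exact (norm_add_le _ _).trans (by gcongr; exact hX t ht)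
    calc γ * ‖(⟪e t, mvE P b⟫ : ℝ)‖ * ‖x t‖ ≤ γ * (‖e t‖ * ‖mvE P b‖) * (‖e t‖ + X) := by gcongr
      _ = _ := by ring
  have hd : ∀ t, ‖mvE Am (e t) + v t‖ ≤ ‖mvCLM Am‖ * ‖e t‖ + vmax := fun t =>
    (norm_add_le _ _).trans (add_le_add ((mvCLM Am).le_opNorm (e t)) (hv t))
  obtain ⟨K, hK0, hK⟩ := exists_parameter_bound (norm_nonneg _) hvmax hg hX0 hc hlevel hT0 hδ0
    he hd hφ hp hxm_cont hX hPE
  obtain ⟨Φ, hΦ⟩ : ∃ Φ, ∀ t, 0 ≤ t → ∫ τ in t..(t + T0), ‖e τ‖ ≤ c * T0 →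
      ∫ τ in t..(t + T0), ‖e τ‖ ^ 2 ≤ c ^ 2 * T0 → ‖φ t‖ ≤ Φ := by
    rcases eq_or_ne b 0 with hb | hb
    · have hφ0 : ∀ t, HasDerivAt φ 0 t := fun t => by
        refine (hφ t).congr_deriv ?_
        simp [hpdef, hb, mvE]
      refine ⟨‖φ 0‖, fun t _ _ _ => le_of_eq ?_⟩
      rw [is_const_of_deriv_eq_zero (fun t => (hφ0 t).differentiableAt)
        (fun t => (hφ0 t).deriv) t 0]
    · refine ⟨K / ‖b‖, fun t ht h1 h2 => ?_⟩
      rw [le_div_iff₀ (norm_pos_iff.2 hb), mul_comm]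
      exact hK t ht h1 h2
  have hV : ∀ t, HasDerivAt (fun s => ⟪e s, mvE P (e s)⟫ + γ⁻¹ * ‖φ s‖ ^ 2)
      (2 * ⟪(mvE Am (e t) + v t) + ⟪φ t, e t + xm t⟫ • b, mvE P (e t)⟫
        + γ⁻¹ * (2 * ⟪φ t, p t⟫)) t := fun t =>
    (hasDerivAt_inner_self_clm (L := mvCLM P) hPs (he t)).add ((hφ t).norm_sq.const_mul γ⁻¹)
  have hV' : ∀ t, 2 * ⟪(mvE Am (e t) + v t) + ⟪φ t, e t + xm t⟫ • b, mvE P (e t)⟫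
        + γ⁻¹ * (2 * ⟪φ t, p t⟫) ≤ eigMin hQ.1 * (c * ‖e t‖ - ‖e t‖ ^ 2) := fun t => by
    have h1 := lyapunov_identity hPT hLyap (e t)
    have h2 := eigMin_mul_sq_le hQ.1 (e t)
    have h3 : ⟪v t, mvE P (e t)⟫ ≤ vmax * (eigMax hP.1 * ‖e t‖) :=
      (real_inner_le_norm _ _).trans
        (mul_le_mul (hv t) (norm_mvE_le_eigMax hP _) (norm_nonneg _) hvmax)
    have h4 : ⟪b, mvE P (e t)⟫ = (⟪e t, mvE P b⟫ : ℝ) := by rw [← hPs, real_inner_comm]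
    have h5 : γ⁻¹ * (2 * ⟪φ t, p t⟫) = -(2 * (⟪φ t, x t⟫ * ⟪e t, mvE P b⟫)) := by
      rw [hpdef, real_inner_smul_right]
      field_simp
    have h6 : eigMin hQ.1 * (c * ‖e t‖) = 2 * eigMax hP.1 * vmax * ‖e t‖ := by
      rw [← hqc]
      ring
    rw [h5, hsum, inner_add_left, inner_add_left, real_inner_smul_left, h4, mul_sub, h6]
    linarith
  have hVM : ∀ t, ⟪e t, mvE P (e t)⟫ + γ⁻¹ * ‖φ t‖ ^ 2 ≤
      (eigMax hP.1 + γ⁻¹) * (‖e t‖ ^ 2 + ‖φ t‖ ^ 2) := fun t => by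
    have h1 := hPup (e t)
    have h2 : 0 ≤ γ⁻¹ * ‖e t‖ ^ 2 := by positivity
    have h3 : 0 ≤ eigMax hP.1 * ‖φ t‖ ^ 2 := by positivity
    linarith
  obtain ⟨B, hB⟩ := exists_lyapunov_bound hg hX0 hc hT0 hq (by positivity) hec hφ hp hV hV' hVM hΦ
  refine ⟨√(B / eigMin hP.1) + √(B * γ) + ‖kstar‖, fun t ht => ?_⟩
  have h1 := hB t ht
  have h2 := eigMin_mul_sq_le hP.1 (e t)
  have h3 : 0 ≤ γ⁻¹ * ‖φ t‖ ^ 2 := by positivity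
  have h4 : 0 ≤ eigMin hP.1 * ‖e t‖ ^ 2 := by positivity
  have h5 : ‖e t‖ ≤ √(B / eigMin hP.1) := by
    refine Real.le_sqrt_of_sq_le ?_
    rw [le_div_iff₀ hl]
    linarith
  have h6 : ‖φ t‖ ≤ √(B * γ) := by
    refine Real.le_sqrt_of_sq_le ?_
    rw [← div_le_iff₀ hγ, div_eq_inv_mul]
    linarith
  have h7 : ‖k t‖ ≤ ‖φ t‖ + ‖kstar‖ := by
    have := norm_add_le (φ t) kstar
    rwa [hφdef, sub_add_cancel] at this
  have h8 := Real.sqrt_nonneg (B / eigMin hP.1)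
  have h9 := Real.sqrt_nonneg (B * γ)
  have h10 := norm_nonneg kstar
  exact ⟨by linarith, by linarith⟩
end
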